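/- Let n ≥ 2 be even, let θ and φ be cyclically ordered real n-tuples, and let β ∈ ℝ with β ∉ ℤ; let N be the unique integer minimizing k ↦ |β − 1/2 − k| over ℤ. Then, as r → 0 within (0,1), r^{−n²/4} · D_n(β, r; θ, φ) converges to π^{−n} · exp(𝑖(β − N − 1/2)c) · V(θ) · V(φ). -/

import Mathlib

open scoped BigOperators

/-- Hyperbolic secant. -/
noncomputable def sech (t : ℝ) : ℝ := 1 / Real.cosh t

/-- The general term of the annulus determinant series: for a strictly increasing integer
tuple `k`, the product of the two Fourier determinants and the `sech` factors. -/
noncomputable def annulusTerm (n : ℕ) (β r : ℝ) (θ φ : Fin n → ℝ) (k : Fin n → ℤ) : ℂ :=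
  (Matrix.of fun i j : Fin n =>
      Complex.exp (Complex.I * ((β : ℂ) - (k i : ℂ)) * (θ j : ℂ))).det *
  (Matrix.of fun i j : Fin n =>
      Complex.exp (-Complex.I * ((β : ℂ) - (k i : ℂ)) * (φ j : ℂ))).det *
  ∏ i : Fin n, ((sech (Real.log (1 / r) * (β - (k i : ℝ))) : ℝ) : ℂ)

/-- The annulus determinant `D_n(β, r; θ, φ)`, summed over all strictly increasing
integer `n`-tuples. -/
noncomputable def annulusD (n : ℕ) (β r : ℝ) (θ φ : Fin n → ℝ) : ℂ :=
  ((2 * Real.pi : ℝ) : ℂ)⁻¹ ^ n *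
    ∑' k : {k : Fin n → ℤ // StrictMono k}, annulusTerm n β r θ φ k.1

/-- `V(θ) = ∏_{i<j} |exp(𝑖θ_j) − exp(𝑖θ_i)|`. -/
noncomputable def Vprod (n : ℕ) (θ : Fin n → ℝ) : ℝ :=
  ∏ p ∈ Finset.univ.filter (fun p : Fin n × Fin n => p.1 < p.2),
    ‖Complex.exp (Complex.I * (θ p.2 : ℂ)) - Complex.exp (Complex.I * (θ p.1 : ℂ))‖

/-- A real tuple `θ` is cyclically ordered if `θ_1 < θ_2 < ⋯ < θ_n < θ_1 + 2π`. -/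
def CyclicallyOrdered {n : ℕ} (θ : Fin n → ℝ) : Prop :=
  StrictMono θ ∧ ∀ i j : Fin n, θ i < θ j + 2 * Real.pi

/-- On the unit circle, a chord between cyclically ordered angles is its length times an
explicit unimodular factor. -/
lemma exp_neg_sub_exp_neg_eq {x y : ℝ} (hxy : x < y) (hyx : y < x + 2 * Real.pi) :
    Complex.exp (-Complex.I * (y : ℂ)) - Complex.exp (-Complex.I * (x : ℂ)) =
      -Complex.I * Complex.exp (-Complex.I / 2 * ((y : ℂ) + (x : ℂ))) *
        (‖Complex.exp (Complex.I * (y : ℂ)) - Complex.exp (Complex.I * (x : ℂ))‖ : ℝ) := by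
  have hsin : 0 < Real.sin ((y - x) / 2) :=
    Real.sin_pos_of_pos_of_lt_pi (by linarith) (by linarith)
  have hnorm : ‖Complex.exp (Complex.I * (y : ℂ)) - Complex.exp (Complex.I * (x : ℂ))‖ =
      2 * Real.sin ((y - x) / 2) := by
    have hfac : Complex.exp (Complex.I * (y : ℂ)) - Complex.exp (Complex.I * (x : ℂ)) =
        Complex.exp (Complex.I * (x : ℂ)) *
          (Complex.exp (Complex.I * ((y - x : ℝ) : ℂ)) - 1) := by
      rw [mul_sub, ← Complex.exp_add]
      push_cast
      ring_nf
    rw [hfac, norm_mul, mul_comm Complex.I (x : ℂ), Complex.norm_exp_ofReal_mul_I, one_mul,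
      Complex.norm_exp_I_mul_ofReal_sub_one, Real.norm_of_nonneg (by positivity)]
  rw [hnorm]
  push_cast
  rw [Complex.two_sin]
  have h1 : Complex.exp (-Complex.I * (y : ℂ)) =
      Complex.exp (-Complex.I / 2 * ((y : ℂ) + (x : ℂ))) *
        Complex.exp (-(((y : ℂ) - x) / 2) * Complex.I) := by
    rw [← Complex.exp_add]
    ring_nf
  have h2 : Complex.exp (-Complex.I * (x : ℂ)) =
      Complex.exp (-Complex.I / 2 * ((y : ℂ) + (x : ℂ))) *
        Complex.exp ((((y : ℂ) - x) / 2) * Complex.I) := by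
    rw [← Complex.exp_add]
    ring_nf
  rw [h1, h2]
  linear_combination (Complex.exp (-Complex.I / 2 * ((y : ℂ) + (x : ℂ))) *
    (Complex.exp (-(((y : ℂ) - x) / 2) * Complex.I) -
      Complex.exp ((((y : ℂ) - x) / 2) * Complex.I))) * Complex.I_mul_I

lemma Vprod_eq_prod_Ioi (n : ℕ) (θ : Fin n → ℝ) :
    Vprod n θ = ∏ i : Fin n, ∏ j ∈ Finset.Ioi i,
      ‖Complex.exp (Complex.I * (θ j : ℂ)) - Complex.exp (Complex.I * (θ i : ℂ))‖ := by
  rw [Vprod, Finset.prod_filter, ← Finset.univ_product_univ, Finset.prod_product]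
  refine Finset.prod_congr rfl fun i _ => ?_
  rw [← Finset.prod_filter]
  exact Finset.prod_congr (by ext; simp) fun _ _ => rfl

/-- The Fourier determinant at the consecutive frequencies `M, M + 1, …, M + n - 1`. -/
lemma det_fourier_consecutive {n : ℕ} {θ : Fin n → ℝ} (hθ : CyclicallyOrdered θ) (β : ℝ)
    (M : ℤ) :
    (Matrix.of fun i j : Fin n =>
        Complex.exp (Complex.I * ((β : ℂ) - ((M + (i : ℕ) : ℤ) : ℂ)) * (θ j : ℂ))).det =
      (∏ i : Fin n, ∏ _j ∈ Finset.Ioi i, -Complex.I) *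
        Complex.exp (Complex.I * (((β - M - ((n : ℝ) - 1) / 2) * ∑ j, θ j : ℝ) : ℂ)) *
        (Vprod n θ : ℂ) := by
  have hmat : (Matrix.of fun i j : Fin n =>
        Complex.exp (Complex.I * ((β : ℂ) - ((M + (i : ℕ) : ℤ) : ℂ)) * (θ j : ℂ))) =
      Matrix.of fun i j => Complex.exp (Complex.I * ((β : ℂ) - (M : ℂ)) * (θ j : ℂ)) *
        (Matrix.vandermonde fun j => Complex.exp (-Complex.I * (θ j : ℂ))).transpose i j := by
    ext i j
    rw [Matrix.of_apply, Matrix.of_apply, Matrix.transpose_apply, Matrix.vandermonde_apply,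
      ← Complex.exp_nat_mul, ← Complex.exp_add]
    push_cast
    ring_nf
  have hsum : ∑ i : Fin n, ∑ j ∈ Finset.Ioi i, (-Complex.I / 2 * ((θ j : ℂ) + (θ i : ℂ))) =
      -Complex.I / 2 * (((n : ℂ) - 1) * ∑ j, (θ j : ℂ)) := by
    simp_rw [← Finset.mul_sum]
    congr 1
    rw [Finset.mul_sum]
    calc ∑ i : Fin n, ∑ j ∈ Finset.Ioi i, ((θ j : ℂ) + (θ i : ℂ))
        = ∑ i : Fin n, ∑ j ∈ Finset.Ioi i, ((θ i : ℂ) + (θ j : ℂ)) := by simp only [add_comm]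
      _ = ∑ i : Fin n, ∑ _j ∈ ({i}ᶜ : Finset (Fin n)), (θ i : ℂ) :=
        Finset.sum_sum_Ioi_add_eq_sum_sum_off_diag fun _ i => (θ i : ℂ)
      _ = ∑ i : Fin n, ((n : ℂ) - 1) * (θ i : ℂ) := by
        refine Finset.sum_congr rfl fun i _ => ?_
        rw [Finset.sum_const, Finset.card_compl, Finset.card_singleton, Fintype.card_fin,
          nsmul_eq_mul, Nat.cast_pred i.pos]
  have hprod : ∏ i : Fin n, ∏ j ∈ Finset.Ioi i,
      (Complex.exp (-Complex.I * (θ j : ℂ)) - Complex.exp (-Complex.I * (θ i : ℂ))) =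
      (∏ i : Fin n, ∏ _j ∈ Finset.Ioi i, -Complex.I) *
        Complex.exp (-Complex.I / 2 * (((n : ℂ) - 1) * ∑ j, (θ j : ℂ))) * (Vprod n θ : ℂ) := by
    rw [Vprod_eq_prod_Ioi, ← hsum, Complex.exp_sum]
    simp_rw [Complex.exp_sum]
    push_cast
    simp_rw [← Finset.prod_mul_distrib]
    refine Finset.prod_congr rfl fun i _ => Finset.prod_congr rfl fun j hj => ?_
    exact exp_neg_sub_exp_neg_eq (hθ.1 (Finset.mem_Ioi.1 hj)) (hθ.2 j i)
  rw [hmat, Matrix.det_mul_row, Matrix.det_transpose, Matrix.det_vandermonde, hprod,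
    ← Complex.exp_sum, ← Finset.mul_sum]
  have hexp : Complex.exp (Complex.I * (((β - M - ((n : ℝ) - 1) / 2) * ∑ j, θ j : ℝ) : ℂ)) =
      Complex.exp (Complex.I * ((β : ℂ) - (M : ℂ)) * ∑ j, (θ j : ℂ)) *
        Complex.exp (-Complex.I / 2 * (((n : ℂ) - 1) * ∑ j, (θ j : ℂ))) := by
    rw [← Complex.exp_add]
    push_cast
    ring_nf
  rw [hexp]
  ring

/-- The two Fourier determinants are exchanged by complex conjugation. -/
lemma det_fourier_neg {n : ℕ} (β : ℝ) (φ : Fin n → ℝ) (k : Fin n → ℤ) :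
    (Matrix.of fun i j : Fin n =>
        Complex.exp (-Complex.I * ((β : ℂ) - (k i : ℂ)) * (φ j : ℂ))).det =
      (starRingEnd ℂ) (Matrix.of fun i j : Fin n =>
        Complex.exp (Complex.I * ((β : ℂ) - (k i : ℂ)) * (φ j : ℂ))).det := by
  rw [RingHom.map_det]
  congr 1
  ext i j
  simp [← Complex.exp_conj]

lemma norm_det_fourier_le {n : ℕ} (β : ℝ) (θ : Fin n → ℝ) (k : Fin n → ℤ) :
    ‖(Matrix.of fun i j : Fin n =>
        Complex.exp (Complex.I * ((β : ℂ) - (k i : ℂ)) * (θ j : ℂ))).det‖ ≤ n.factorial := by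
  have h := Matrix.det_le (abv := IsAbsoluteValue.toAbsoluteValue (norm : ℂ → ℝ))
    (A := Matrix.of fun i j : Fin n =>
      Complex.exp (Complex.I * ((β : ℂ) - (k i : ℂ)) * (θ j : ℂ))) (x := 1) ?_
  · simpa using h
  · intro i j
    refine le_of_eq ?_
    have : Complex.I * ((β : ℂ) - (k i : ℂ)) * (θ j : ℂ) =
        (((β - k i) * θ j : ℝ) : ℂ) * Complex.I := by
      push_cast
      ring
    simp only [Matrix.of_apply, this]
    exact Complex.norm_exp_ofReal_mul_I _

/-- The `sech` weight is a power of `r` up to a factor tending to `2`. -/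
lemma sech_log_one_div_mul {r : ℝ} (hr : 0 < r) (x : ℝ) :
    sech (Real.log (1 / r) * x) = r ^ |x| * (2 / (1 + r ^ (2 * |x|))) := by
  have hcosh : Real.cosh (Real.log (1 / r) * x) = Real.cosh (Real.log r * |x|) := by
    rw [← Real.cosh_abs, ← Real.cosh_abs (Real.log r * |x|), abs_mul, abs_mul, abs_abs,
      one_div, Real.log_inv, abs_neg]
  rw [sech, hcosh, Real.cosh_eq, Real.exp_neg, ← Real.rpow_def_of_pos hr, mul_comm 2 |x|,
    Real.rpow_mul hr.le]
  have := Real.rpow_pos_of_pos hr |x|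
  norm_cast
  field_simp
  ring

lemma prod_sech_log {r : ℝ} (hr : 0 < r) {n : ℕ} (x : Fin n → ℝ) :
    ∏ i, sech (Real.log (1 / r) * x i) =
      r ^ (∑ i, |x i|) * ∏ i, (2 / (1 + r ^ (2 * |x i|))) := by
  simp_rw [sech_log_one_div_mul hr, Finset.prod_mul_distrib, Real.rpow_sum_of_pos hr]

lemma tendsto_rpow_nhdsWithin_Ioo {e : ℝ} (he : 0 < e) :
    Filter.Tendsto (fun r : ℝ => r ^ e) (nhdsWithin 0 (Set.Ioo (0 : ℝ) 1)) (nhds 0) := by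
  have h := (Real.continuousAt_rpow_const 0 e (Or.inr he.le)).tendsto
  rw [Real.zero_rpow he.ne'] at h
  exact h.mono_left nhdsWithin_le_nhds

lemma tendsto_prod_two_div {n : ℕ} {x : Fin n → ℝ} (hx : ∀ i, x i ≠ 0) :
    Filter.Tendsto (fun r : ℝ => ∏ i, (2 / (1 + r ^ (2 * |x i|))))
      (nhdsWithin 0 (Set.Ioo (0 : ℝ) 1)) (nhds (2 ^ n)) := by
  have h := tendsto_finsetProd (Finset.univ : Finset (Fin n)) fun i _ =>
    (tendsto_const_nhds (x := (2 : ℝ))).div ((tendsto_rpow_nhdsWithin_Ioo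
      (e := 2 * |x i|) (mul_pos two_pos (abs_pos.2 (hx i)))).const_add 1) (by norm_num)
  simpa using h

lemma Summable.prod_pi_of_nonneg {α : Type*} {n : ℕ} {f : α → ℝ} (hf : Summable f)
    (h0 : ∀ a, 0 ≤ f a) : Summable fun k : Fin n → α => ∏ i, f (k i) := by
  classical
  refine summable_of_sum_le (c := (∑' a, f a) ^ n)
    (fun k => Finset.prod_nonneg fun i _ => h0 _) fun u => ?_
  calc ∑ k ∈ u, ∏ i, f (k i)
      ≤ ∑ k ∈ Fintype.piFinset fun i => u.image fun k => k i, ∏ i, f (k i) :=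
        Finset.sum_le_sum_of_subset_of_nonneg
          (fun k hk => Fintype.mem_piFinset.2 fun i => Finset.mem_image_of_mem _ hk)
          fun k _ _ => Finset.prod_nonneg fun i _ => h0 _
    _ = ∏ i : Fin n, ∑ a ∈ u.image (fun k => k i), f a := (Finset.prod_univ_sum _ _).symm
    _ ≤ ∏ _i : Fin n, ∑' a, f a :=
        Finset.prod_le_prod (fun i _ => Finset.sum_nonneg fun a _ => h0 a)
          fun i _ => hf.sum_le_tsum _ fun a _ => h0 a
    _ = (∑' a, f a) ^ n := by simp

lemma summable_half_rpow_abs_sub (β : ℝ) :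
    Summable fun k : ℤ => (1 / 2 : ℝ) ^ |β - (k : ℝ)| := by
  have hg : Summable fun k : ℤ => (1 / 2 : ℝ) ^ |(k : ℝ)| := by
    apply Summable.of_nat_of_neg <;> simpa using summable_geometric_two
  refine Summable.of_nonneg_of_le (fun k => by positivity) (fun k => ?_)
    (hg.mul_left ((1 / 2 : ℝ) ^ (-|β|)))
  rw [← Real.rpow_add (by norm_num)]
  refine Real.rpow_le_rpow_of_exponent_ge (by norm_num) (by norm_num) ?_
  have := abs_sub_abs_le_abs_sub (k : ℝ) β
  rw [abs_sub_comm] at this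
  linarith

/-- The `2 * m` integers closest to a non-integer real `β` with floor `N` have total distance
`m ^ 2` from it. -/
lemma sum_abs_sub_consecutive {β : ℝ} {N : ℤ} (h1 : (N : ℝ) < β) (h2 : β < N + 1) (m : ℕ) :
    ∑ i : Fin (2 * m), |β - ((N - m + 1 + (i : ℕ) : ℤ) : ℝ)| = (m : ℝ) ^ 2 := by
  rw [Fin.sum_univ_eq_sum_range fun i => |β - ((N - m + 1 + (i : ℕ) : ℤ) : ℝ)|]
  induction m with
  | zero => simp
  | succ m ih =>
    rw [show 2 * (m + 1) = 2 * m + 1 + 1 by ring, Finset.sum_range_succ,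
      Finset.sum_range_succ']
    have hs : ∑ i ∈ Finset.range (2 * m),
        |β - ((N - (m + 1 : ℕ) + 1 + ((i + 1 : ℕ) : ℤ) : ℤ) : ℝ)| = (m : ℝ) ^ 2 := by
      rw [← ih]
      refine Finset.sum_congr rfl fun i _ => ?_
      push_cast
      ring_nf
    rw [hs, abs_of_nonneg, abs_of_nonpos]
    · push_cast
      ring
    · push_cast
      linarith [(Nat.cast_nonneg m : (0 : ℝ) ≤ m)]
    · push_cast
      linarith [(Nat.cast_nonneg m : (0 : ℝ) ≤ m)]

/-- The `2 * m` integers closest to a non-integer real `β` are the unique minimizers of the total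
distance to `β`. -/
lemma sq_lt_sum_abs_sub {β : ℝ} {N : ℤ} (h1 : (N : ℝ) < β) (h2 : β < N + 1) {m : ℕ}
    {k : Fin (2 * m) → ℤ} (hk : StrictMono k)
    (hne : k ≠ fun i : Fin (2 * m) => N - m + 1 + (i : ℕ)) :
    (m : ℝ) ^ 2 < ∑ i, |β - (k i : ℝ)| := by
  classical
  set k₀ : Fin (2 * m) → ℤ := fun i => N - m + 1 + (i : ℕ) with hk₀
  have hk₀m : StrictMono k₀ := fun i j hij => by simpa [hk₀] using hij
  set T := Finset.univ.image k with hT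
  set S := Finset.univ.image k₀ with hS
  have hcT : T.card = 2 * m := by simp [hT, Finset.card_image_of_injective _ hk.injective]
  have hcS : S.card = 2 * m := by simp [hS, Finset.card_image_of_injective _ hk₀m.injective]
  have hTS : T ≠ S := fun h => hne <| (hk.range_inj hk₀m).1 <| by
    have := congrArg (fun s : Finset ℤ => (s : Set ℤ)) h
    simpa [hT, hS] using this
  have hin : ∀ a ∈ S, |β - (a : ℝ)| - m ≤ 0 := by
    intro a ha
    obtain ⟨i, -, rfl⟩ := Finset.mem_image.1 ha
    have hi : ((i : ℕ) : ℝ) + 1 ≤ 2 * m := by exact_mod_cast i.2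
    have hi0 : (0 : ℝ) ≤ ((i : ℕ) : ℝ) := Nat.cast_nonneg _
    rw [sub_nonpos, abs_le]
    simp only [hk₀]
    push_cast
    constructor <;> linarith
  have hout : ∀ a ∉ S, 0 < |β - (a : ℝ)| - m := by
    intro a ha
    rw [sub_pos, lt_abs]
    by_contra! hcon
    apply ha
    have ha1 : N - m < a := by
      have : (N : ℝ) - m < a := by linarith [hcon.1]
      exact_mod_cast this
    have ha2 : a < N + m + 1 := by
      have : (a : ℝ) < N + m + 1 := by linarith [hcon.2]
      exact_mod_cast this
    refine Finset.mem_image.2 ⟨⟨(a - (N - m + 1)).toNat, by omega⟩, Finset.mem_univ _, ?_⟩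
    simp only [hk₀]
    omega
  obtain ⟨b, hbT, hbS⟩ : ∃ b ∈ T, b ∉ S := by
    by_contra! hcon
    exact hTS (Finset.eq_of_subset_of_card_le hcon (by rw [hcT, hcS]))
  have hlt : ∑ a ∈ S, (|β - (a : ℝ)| - m) < ∑ a ∈ T, (|β - (a : ℝ)| - m) := by
    rw [← Finset.sum_inter_add_sum_sdiff S T, ← Finset.sum_inter_add_sum_sdiff T S,
      Finset.inter_comm T S]
    refine add_lt_add_right ?_ _
    calc _ ≤ (0 : ℝ) := Finset.sum_nonpos fun a ha => hin a (Finset.mem_sdiff.1 ha).1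
      _ < _ := Finset.sum_pos (fun a ha => hout a (Finset.mem_sdiff.1 ha).2)
        ⟨b, Finset.mem_sdiff.2 ⟨hbT, hbS⟩⟩
  rw [Finset.sum_sub_distrib, Finset.sum_sub_distrib, Finset.sum_const, Finset.sum_const, hcT,
    hcS, sub_lt_sub_iff_right, hT, hS, Finset.sum_image hk.injective.injOn,
    Finset.sum_image hk₀m.injective.injOn] at hlt
  rwa [← sum_abs_sub_consecutive h1 h2 m]

lemma eq_floor_of_nearest {β : ℝ} {N : ℤ}
    (hN : ∀ k : ℤ, k ≠ N → |β - 1 / 2 - (N : ℝ)| < |β - 1 / 2 - (k : ℝ)|) : N = ⌊β⌋ := by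
  by_contra hne
  have hlt := hN ⌊β⌋ (Ne.symm hne)
  have h1 : |β - 1 / 2 - (⌊β⌋ : ℝ)| ≤ 1 / 2 := by
    rw [abs_le]
    constructor <;> linarith [Int.floor_le β, Int.lt_floor_add_one β]
  have h2 := abs_lt.1 (hlt.trans_le h1)
  refine hne (Int.floor_eq_iff.2 ⟨?_, ?_⟩).symm <;> linarith [h2.1, h2.2]

/-- The normalized general term, with the powers of `r` collected. -/
lemma rpow_mul_annulusTerm {n : ℕ} {β r : ℝ} (hr : 0 < r) (e : ℝ) (θ φ : Fin n → ℝ)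
    (k : Fin n → ℤ) :
    ((r ^ (-e) : ℝ) : ℂ) * annulusTerm n β r θ φ k =
      (Matrix.of fun i j : Fin n =>
        Complex.exp (Complex.I * ((β : ℂ) - (k i : ℂ)) * (θ j : ℂ))).det *
      (Matrix.of fun i j : Fin n =>
        Complex.exp (-Complex.I * ((β : ℂ) - (k i : ℂ)) * (φ j : ℂ))).det *
      ((r ^ (∑ i, |β - (k i : ℝ)| - e) * ∏ i, (2 / (1 + r ^ (2 * |β - (k i : ℝ)|))) : ℝ) : ℂ) := by
  rw [annulusTerm, ← Complex.ofReal_prod, prod_sech_log hr, sub_eq_neg_add,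
    Real.rpow_add hr (-e)]
  push_cast
  ring

lemma norm_rpow_mul_annulusTerm_le {n : ℕ} {β r : ℝ} (hr : 0 < r) (hr2 : r ≤ 1 / 2) {e : ℝ}
    (θ φ : Fin n → ℝ) {k : Fin n → ℤ} (hk : e ≤ ∑ i, |β - (k i : ℝ)|) :
    ‖((r ^ (-e) : ℝ) : ℂ) * annulusTerm n β r θ φ k‖ ≤
      (n.factorial : ℝ) ^ 2 * 2 ^ n * (1 / 2) ^ (-e) *
        ∏ i, (1 / 2 : ℝ) ^ |β - (k i : ℝ)| := by
  have hbound : r ^ (∑ i, |β - (k i : ℝ)| - e) ≤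
      (1 / 2 : ℝ) ^ (-e) * ∏ i, (1 / 2 : ℝ) ^ |β - (k i : ℝ)| := by
    rw [← Real.rpow_sum_of_pos (by norm_num), ← Real.rpow_add (by norm_num), ← sub_eq_neg_add]
    exact Real.rpow_le_rpow hr.le hr2 (sub_nonneg.2 hk)
  have hprod : ∏ i, (2 / (1 + r ^ (2 * |β - (k i : ℝ)|))) ≤ (2 : ℝ) ^ n := by
    calc _ ≤ ∏ _i : Fin n, (2 : ℝ) := Finset.prod_le_prod (fun i _ => by positivity) fun i _ =>
          div_le_self (by norm_num) (by linarith [Real.rpow_nonneg hr.le (2 * |β - (k i : ℝ)|)])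
      _ = 2 ^ n := by simp
  have hprod0 : 0 ≤ ∏ i, (2 / (1 + r ^ (2 * |β - (k i : ℝ)|))) :=
    Finset.prod_nonneg fun i _ => by positivity
  rw [rpow_mul_annulusTerm hr, det_fourier_neg, norm_mul, norm_mul, RCLike.norm_conj,
    Complex.norm_real, Real.norm_of_nonneg (by positivity)]
  calc _ ≤ (n.factorial : ℝ) * n.factorial *
        (((1 / 2 : ℝ) ^ (-e) * ∏ i, (1 / 2 : ℝ) ^ |β - (k i : ℝ)|) * 2 ^ n) := by
        gcongr <;> apply norm_det_fourier_le
    _ = _ := by ring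

/-- The product of the two Fourier determinants at the dominant frequencies. -/
lemma det_mul_det_consecutive {m : ℕ} {θ φ : Fin (2 * m) → ℝ} (hθ : CyclicallyOrdered θ)
    (hφ : CyclicallyOrdered φ) (β : ℝ) (N : ℤ) :
    (Matrix.of fun i j : Fin (2 * m) =>
        Complex.exp (Complex.I * ((β : ℂ) - ((N - m + 1 + (i : ℕ) : ℤ) : ℂ)) * (θ j : ℂ))).det *
      (Matrix.of fun i j : Fin (2 * m) =>
        Complex.exp (-Complex.I * ((β : ℂ) - ((N - m + 1 + (i : ℕ) : ℤ) : ℂ)) *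
          (φ j : ℂ))).det =
      Complex.exp (Complex.I * (((β - (N : ℝ) - 1 / 2) * (∑ j, θ j - ∑ j, φ j) : ℝ) : ℂ)) *
        (Vprod (2 * m) θ : ℂ) * (Vprod (2 * m) φ : ℂ) := by
  rw [det_fourier_neg β φ fun i => N - m + 1 + (i : ℕ), det_fourier_consecutive hθ,
    det_fourier_consecutive hφ, map_mul, map_mul, Complex.conj_ofReal, ← Complex.exp_conj,
    map_mul, Complex.conj_I, Complex.conj_ofReal]
  have hunit : (∏ i : Fin (2 * m), ∏ _j ∈ Finset.Ioi i, -Complex.I) *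
      (starRingEnd ℂ) (∏ i : Fin (2 * m), ∏ _j ∈ Finset.Ioi i, -Complex.I) = 1 := by
    rw [Complex.mul_conj']
    simp [norm_prod]
  have hexp : Complex.exp (Complex.I *
        (((β - (N : ℝ) - 1 / 2) * (∑ j, θ j - ∑ j, φ j) : ℝ) : ℂ)) =
      Complex.exp (Complex.I *
        (((β - (N - m + 1 : ℤ) - (((2 * m : ℕ) : ℝ) - 1) / 2) * ∑ j, θ j : ℝ) : ℂ)) *
      Complex.exp (-Complex.I *
        (((β - (N - m + 1 : ℤ) - (((2 * m : ℕ) : ℝ) - 1) / 2) * ∑ j, φ j : ℝ) : ℂ)) := by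
    rw [← Complex.exp_add]
    push_cast
    ring_nf
  rw [hexp]
  linear_combination (Complex.exp (Complex.I *
        (((β - (N - m + 1 : ℤ) - (((2 * m : ℕ) : ℝ) - 1) / 2) * ∑ j, θ j : ℝ) : ℂ)) *
      Complex.exp (-Complex.I *
        (((β - (N - m + 1 : ℤ) - (((2 * m : ℕ) : ℝ) - 1) / 2) * ∑ j, φ j : ℝ) : ℂ)) *
      (Vprod (2 * m) θ : ℂ) * (Vprod (2 * m) φ : ℂ)) * hunit

/-- even `n` asymptotics of the annulus determinant as `r → 0`. -/
theorem annulusD_tendsto_even (n : ℕ) (hn : 2 ≤ n) (heven : Even n)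
    (θ φ : Fin n → ℝ) (hθ : CyclicallyOrdered θ) (hφ : CyclicallyOrdered φ)
    (β : ℝ) (hβ : ∀ m : ℤ, β ≠ (m : ℝ)) (N : ℤ)
    (hN : ∀ k : ℤ, k ≠ N → |β - 1 / 2 - (N : ℝ)| < |β - 1 / 2 - (k : ℝ)|) :
    Filter.Tendsto
      (fun r : ℝ =>
        ((r ^ (-((n : ℝ) ^ 2 / 4)) : ℝ) : ℂ) * annulusD n β r θ φ)
      (nhdsWithin 0 (Set.Ioo (0 : ℝ) 1))
      (nhds (((Real.pi : ℂ) ^ n)⁻¹ *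
        Complex.exp (Complex.I *
          (((β - (N : ℝ) - 1 / 2) * (∑ j, θ j - ∑ j, φ j) : ℝ) : ℂ)) *
        (Vprod n θ : ℂ) * (Vprod n φ : ℂ))) := by
  obtain ⟨m, rfl⟩ := even_iff_exists_two_mul.1 heven
  have hNfl := eq_floor_of_nearest hN
  have h1 : (N : ℝ) < β := lt_of_le_of_ne (hNfl ▸ Int.floor_le β) (hβ N).symm
  have h2 : β < N + 1 := hNfl ▸ Int.lt_floor_add_one β
  have hsq : ((2 * m : ℕ) : ℝ) ^ 2 / 4 = (m : ℝ) ^ 2 := by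
    push_cast
    ring
  rw [hsq]
  set k₀ : {k : Fin (2 * m) → ℤ // StrictMono k} :=
    ⟨fun i => N - m + 1 + (i : ℕ), fun i j hij => by simpa using hij⟩
  set G : ℂ := Complex.exp (Complex.I *
      (((β - (N : ℝ) - 1 / 2) * (∑ j, θ j - ∑ j, φ j) : ℝ) : ℂ)) *
    (Vprod (2 * m) θ : ℂ) * (Vprod (2 * m) φ : ℂ) with hG
  have hmem : ∀ᶠ r : ℝ in nhdsWithin 0 (Set.Ioo (0 : ℝ) 1), 0 < r ∧ r ≤ 1 / 2 := by
    filter_upwards [self_mem_nhdsWithin,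
      nhdsWithin_le_nhds (Iic_mem_nhds (show (0 : ℝ) < 1 / 2 by norm_num))] with r hr hr'
    exact ⟨hr.1, hr'⟩
  have hge : ∀ k : {k : Fin (2 * m) → ℤ // StrictMono k},
      (m : ℝ) ^ 2 ≤ ∑ i, |β - (k.1 i : ℝ)| := fun k => by
    by_cases hk : k = k₀
    · rw [hk]
      exact (sum_abs_sub_consecutive h1 h2 m).ge
    · exact (sq_lt_sum_abs_sub h1 h2 k.2 fun h => hk (Subtype.ext h)).le
  have hterm : ∀ k : {k : Fin (2 * m) → ℤ // StrictMono k}, Filter.Tendsto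
      (fun r : ℝ => ((r ^ (-(m : ℝ) ^ 2) : ℝ) : ℂ) * annulusTerm (2 * m) β r θ φ k.1)
      (nhdsWithin 0 (Set.Ioo (0 : ℝ) 1)) (nhds (if k = k₀ then G * 2 ^ (2 * m) else 0)) := by
    intro k
    have hprod := tendsto_prod_two_div (x := fun i => β - (k.1 i : ℝ))
      fun i => sub_ne_zero.2 (hβ _)
    refine Filter.Tendsto.congr'
      (hmem.mono fun r hr => (rpow_mul_annulusTerm hr.1 _ θ φ k.1).symm) ?_
    split_ifs with hk
    · subst hk
      have hsum : ∑ i, |β - (k₀.1 i : ℝ)| = (m : ℝ) ^ 2 := sum_abs_sub_consecutive h1 h2 m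
      rw [hG, ← det_mul_det_consecutive hθ hφ β N]
      simp only [hsum, sub_self, Real.rpow_zero, one_mul]
      refine Filter.Tendsto.const_mul _ ?_
      have h := (Complex.continuous_ofReal.tendsto _).comp hprod
      rwa [Complex.ofReal_pow, Complex.ofReal_ofNat] at h
    · have hlt := sq_lt_sum_abs_sub h1 h2 k.2 fun h => hk (Subtype.ext h)
      have h0 := (tendsto_rpow_nhdsWithin_Ioo (sub_pos.2 hlt)).mul hprod
      rw [zero_mul] at h0
      simpa using ((Complex.continuous_ofReal.tendsto _).comp h0).const_mul _
  have hsummable := (((summable_half_rpow_abs_sub β).prod_pi_of_nonneg (n := 2 * m)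
    fun a => by positivity).comp_injective
      (Subtype.val_injective (p := fun k : Fin (2 * m) → ℤ => StrictMono k))).mul_left
      (((2 * m).factorial : ℝ) ^ 2 * 2 ^ (2 * m) * (1 / 2 : ℝ) ^ (-(m : ℝ) ^ 2))
  have hlim := tendsto_tsum_of_dominated_convergence hsummable hterm
    (hmem.mono fun r hr k => norm_rpow_mul_annulusTerm_le hr.1 hr.2 θ φ (hge k))
  rw [tsum_ite_eq] at hlim
  have hfinal := hlim.const_mul (((2 * Real.pi : ℝ) : ℂ)⁻¹ ^ (2 * m))
  have hval : ((2 * Real.pi : ℝ) : ℂ)⁻¹ ^ (2 * m) * (G * 2 ^ (2 * m)) =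
      ((Real.pi : ℂ) ^ (2 * m))⁻¹ * G := by
    push_cast
    rw [mul_inv, mul_pow, inv_pow, inv_pow]
    field_simp
  rw [hval] at hfinal
  simp only [mul_assoc, hG] at hfinal ⊢
  refine hfinal.congr fun r => ?_
  rw [annulusD, tsum_mul_left]
  ring
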